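/- Let H be a c-colored digraph possessing an up-color kernel, and let G be obtained from H by adding a new vertex v and the arc (w,v) for some w ∈ V(H). Then G has an up-color kernel if and only if either (c(v) > c(w) and H \ {w} has an up-color kernel) or (0 < c(v) ≤ c(w) and H has an up-color kernel not containing w). -/

import Mathlib

def UpColorKernel {V : Type*} (A : V → V → Prop) (c : V → ℕ) (K : Set V) : Prop :=
  (∀ v ∈ K, ∀ w ∈ K, ¬ A v w) ∧
  (∀ v ∈ K, c v ≠ 0) ∧
  (∀ v, v ∉ K → ∃ w ∈ K, A v w ∧ c v < c w)

/-- The digraph `G` obtained from `H` (arc relation `A`) by adding a new vertex `none`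
and the outward pendant arc `(w, v)` where `v = none`. -/
def pendantArc {V : Type*} (A : V → V → Prop) (w : V) : Option V → Option V → Prop
  | some u, some v => A u v
  | some u, none => u = w
  | none, _ => False

/-- `G` has an up-color kernel iff the new vertex has nonzero color and some independent set `S`
of `H` avoids `w` and the color `0`, and absorbs every other vertex, except that `w` may instead be
absorbed by the new vertex. -/
theorem exists_upColorKernel_pendantArc_iff {V : Type*} (A : V → V → Prop) (w : V)
    (c : Option V → ℕ) :
    (∃ K : Set (Option V), UpColorKernel (pendantArc A w) c K) ↔
    0 < c none ∧ ∃ S : Set V, w ∉ S ∧ (∀ v ∈ S, ∀ u ∈ S, ¬ A v u) ∧ (∀ v ∈ S, c (some v) ≠ 0) ∧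
      ∀ v ∉ S, (v = w ∧ c (some w) < c none) ∨ ∃ u ∈ S, A v u ∧ c (some v) < c (some u) := by
  constructor
  · rintro ⟨K, hind, hcol, habs⟩
    have hnone : none ∈ K := by
      by_contra h
      obtain ⟨_, -, harc, -⟩ := habs none h
      exact harc
    refine ⟨Nat.pos_of_ne_zero (hcol none hnone), {v | some v ∈ K},
      fun hw => hind _ hw _ hnone rfl, fun v hv u hu => hind _ hv _ hu,
      fun v hv => hcol _ hv, fun v hv => ?_⟩
    obtain ⟨_ | u, hu, harc, hlt⟩ := habs (some v) hv
    · obtain rfl : v = w := harc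
      exact Or.inl ⟨rfl, hlt⟩
    · exact Or.inr ⟨u, hu, harc, hlt⟩
  · rintro ⟨hpos, S, hw, hind, hcol, habs⟩
    refine ⟨insert none (some '' S), ?_, ?_, ?_⟩
    · rintro _ (rfl | ⟨v, hv, rfl⟩) _ (rfl | ⟨u, hu, rfl⟩) harc
      · exact harc
      · exact harc
      · obtain rfl : v = w := harc
        exact hw hv
      · exact hind v hv u hu harc
    · rintro _ (rfl | ⟨v, hv, rfl⟩)
      · exact hpos.ne'
      · exact hcol v hv
    · rintro (_ | v) hv
      · exact absurd (Set.mem_insert _ _) hv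
      · have hvS : v ∉ S := fun h => hv (Or.inr ⟨v, h, rfl⟩)
        obtain ⟨rfl, hlt⟩ | ⟨u, hu, harc, hlt⟩ := habs v hvS
        · exact ⟨none, Or.inl rfl, rfl, hlt⟩
        · exact ⟨some u, Or.inr ⟨u, hu, rfl⟩, harc, hlt⟩

/-- If `H` has an up-color kernel and `G` is obtained from `H` by adding an outward pendant
arc `(w, v)`, then `G` has an up-color kernel iff either `c v > c w` and `H ∖ {w}` has an
up-color kernel, or `0 < c v ≤ c w` and `H` has an up-color kernel not containing `w`. -/
theorem pendant_upColorKernel_iff {V : Type*} (A : V → V → Prop) (w : V)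
    (c : Option V → ℕ)
    (hH : ∃ K : Set V, UpColorKernel A (fun v => c (some v)) K) :
    (∃ K : Set (Option V), UpColorKernel (pendantArc A w) c K) ↔
    ((c (some w) < c none ∧
        ∃ K : Set {v : V // v ≠ w},
          UpColorKernel (fun u v : {v : V // v ≠ w} => A u.1 v.1)
            (fun v => c (some v.1)) K) ∨
     (0 < c none ∧ c none ≤ c (some w) ∧
        ∃ K : Set V, UpColorKernel A (fun v => c (some v)) K ∧ w ∉ K)) := by
  rw [exists_upColorKernel_pendantArc_iff]
  constructor
  · rintro ⟨hpos, S, hw, hind, hcol, habs⟩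
    rcases lt_or_ge (c (some w)) (c none) with hlt | hle
    · refine Or.inl ⟨hlt, {v | v.1 ∈ S}, fun v hv u hu => hind _ hv _ hu,
        fun v hv => hcol _ hv, fun v hv => ?_⟩
      obtain ⟨hvw, -⟩ | ⟨u, hu, harc, hvu⟩ := habs v.1 hv
      · exact absurd hvw v.2
      · exact ⟨⟨u, ne_of_mem_of_not_mem hu hw⟩, hu, harc, hvu⟩
    · refine Or.inr ⟨hpos, hle, S, ⟨hind, hcol, fun v hv => ?_⟩, hw⟩
      exact (habs v hv).resolve_left fun h => hle.not_gt h.2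
  · rintro (⟨hlt, K, hind, hcol, habs⟩ | ⟨hpos, -, S, ⟨hind, hcol, habs⟩, hw⟩)
    · refine ⟨(Nat.zero_le _).trans_lt hlt, Subtype.val '' K, ?_, ?_, ?_, fun v hv => ?_⟩
      · rintro ⟨v, -, hvw⟩
        exact v.2 hvw
      · rintro _ ⟨v, hv, rfl⟩ _ ⟨u, hu, rfl⟩
        exact hind v hv u hu
      · rintro _ ⟨v, hv, rfl⟩
        exact hcol v hv
      · by_cases hvw : v = w
        · exact Or.inl ⟨hvw, hlt⟩
        · obtain ⟨u, hu, harc, hvu⟩ := habs ⟨v, hvw⟩ fun h => hv ⟨_, h, rfl⟩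
          exact Or.inr ⟨u, ⟨u, hu, rfl⟩, harc, hvu⟩
    · exact ⟨hpos, S, hw, hind, hcol, fun v hv => Or.inr (habs v hv)⟩
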